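/- Duality of extremal antinorms for the lower spectral radius (normalized case): let 𝒜 be a compact nonempty family of d×d matrices with nonnegative entries and let f be a continuous antinorm on ℝ^d₊. If inf{f(Ax) : x ∈ ℝ^d₊, f(x) ≥ 1, A ∈ 𝒜} = 1, then inf{f*(Aᵀp) : p ∈ ℝ^d₊, f*(p) ≥ 1, A ∈ 𝒜} = 1; i.e., if f is an extremal antinorm for 𝒜 (with lower spectral radius normalized to 1), then f* is an extremal antinorm for the transposed family 𝒜ᵀ = {Aᵀ : A ∈ 𝒜}. -/

import Mathlib

open scoped BigOperators

noncomputable section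

/-- The positive orthant in `ℝ^d`. -/
def pos (d : ℕ) : Set (Fin d → ℝ) := {x | ∀ i, 0 ≤ x i}

/-- Euclidean inner product of two vectors. -/
def dot {d : ℕ} (p x : Fin d → ℝ) : ℝ := ∑ i, p i * x i

/-- An antinorm on the positive orthant: nonnegative, positively homogeneous,
concave and strictly positive somewhere. -/
def IsAntinorm {d : ℕ} (f : (Fin d → ℝ) → ℝ) : Prop :=
  (∀ x ∈ pos d, 0 ≤ f x) ∧
  (∀ x ∈ pos d, ∀ l : ℝ, 0 ≤ l → f (l • x) = l * f x) ∧
  ConcaveOn ℝ (pos d) f ∧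
  ∃ x ∈ pos d, 0 < f x

/-- The dual antinorm `f*(p) = inf {⟨p,x⟩/f(x) : x ∈ ℝ^d₊, f(x) ≠ 0}`. -/
def dualAntinorm {d : ℕ} (f : (Fin d → ℝ) → ℝ) (p : Fin d → ℝ) : ℝ :=
  sInf ((fun x => dot p x / f x) '' {x | x ∈ pos d ∧ f x ≠ 0})

theorem dot_nonneg {d : ℕ} {p x : Fin d → ℝ} (hp : p ∈ pos d) (hx : x ∈ pos d) :
    0 ≤ dot p x :=
  Finset.sum_nonneg fun i _ => mul_nonneg (hp i) (hx i)

theorem dot_smul_left {d : ℕ} (l : ℝ) (p x : Fin d → ℝ) : dot (l • p) x = l * dot p x :=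
  smul_dotProduct l p x

theorem dot_smul_right {d : ℕ} (l : ℝ) (p x : Fin d → ℝ) : dot p (l • x) = l * dot p x :=
  dotProduct_smul l p x

theorem dot_transpose_mulVec {d : ℕ} (A : Matrix (Fin d) (Fin d) ℝ) (p x : Fin d → ℝ) :
    dot (A.transpose.mulVec p) x = dot p (A.mulVec x) := by
  change A.transpose.mulVec p ⬝ᵥ x = p ⬝ᵥ A.mulVec x
  rw [Matrix.mulVec_transpose, Matrix.dotProduct_mulVec]

theorem smul_mem_pos {d : ℕ} {l : ℝ} (hl : 0 ≤ l) {x : Fin d → ℝ} (hx : x ∈ pos d) :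
    l • x ∈ pos d :=
  fun i => mul_nonneg hl (hx i)

theorem add_mem_pos {d : ℕ} {x y : Fin d → ℝ} (hx : x ∈ pos d) (hy : y ∈ pos d) :
    x + y ∈ pos d :=
  fun i => add_nonneg (hx i) (hy i)

theorem mulVec_mem_pos {d : ℕ} {A : Matrix (Fin d) (Fin d) ℝ} (hA : ∀ i j, 0 ≤ A i j)
    {x : Fin d → ℝ} (hx : x ∈ pos d) : A.mulVec x ∈ pos d :=
  fun i => dotProduct_nonneg_of_nonneg (hA i) hx

theorem isClosed_pos (d : ℕ) : IsClosed (pos d) := by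
  simp only [pos, Set.ofPred_forall]
  exact isClosed_iInter fun i => isClosed_le continuous_const (continuous_apply i)

theorem dualAntinorm_nonneg {d : ℕ} {f : (Fin d → ℝ) → ℝ} (hf : IsAntinorm f)
    {p : Fin d → ℝ} (hp : p ∈ pos d) : 0 ≤ dualAntinorm f p := by
  refine Real.sInf_nonneg ?_
  rintro _ ⟨x, ⟨hx, -⟩, rfl⟩
  exact div_nonneg (dot_nonneg hp hx) (hf.1 x hx)

theorem dualAntinorm_mul_le_dot {d : ℕ} {f : (Fin d → ℝ) → ℝ} (hf : IsAntinorm f)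
    {p x : Fin d → ℝ} (hp : p ∈ pos d) (hx : x ∈ pos d) :
    dualAntinorm f p * f x ≤ dot p x := by
  rcases (hf.1 x hx).eq_or_lt with h | h
  · rw [← h, mul_zero]
    exact dot_nonneg hp hx
  · rw [← le_div_iff₀ h]
    refine csInf_le ⟨0, ?_⟩ ⟨x, ⟨hx, h.ne'⟩, rfl⟩
    rintro _ ⟨y, ⟨hy, -⟩, rfl⟩
    exact div_nonneg (dot_nonneg hp hy) (hf.1 y hy)

theorem le_dualAntinorm {d : ℕ} {f : (Fin d → ℝ) → ℝ} (hf : IsAntinorm f)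
    {p : Fin d → ℝ} {c : ℝ} (h : ∀ x ∈ pos d, 0 < f x → c * f x ≤ dot p x) :
    c ≤ dualAntinorm f p := by
  obtain ⟨x, hx, hfx⟩ := hf.2.2.2
  refine le_csInf ⟨_, x, ⟨hx, hfx.ne'⟩, rfl⟩ ?_
  rintro _ ⟨y, ⟨hy, hfy⟩, rfl⟩
  have hfy' := (hf.1 y hy).lt_of_ne' hfy
  exact (le_div_iff₀ hfy').2 (h y hy hfy')

theorem dualAntinorm_smul {d : ℕ} (f : (Fin d → ℝ) → ℝ) {l : ℝ} (hl : 0 ≤ l)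
    (p : Fin d → ℝ) : dualAntinorm f (l • p) = l * dualAntinorm f p := by
  rw [dualAntinorm, dualAntinorm, ← smul_eq_mul, ← Real.sInf_smul_of_nonneg hl,
    ← Set.image_smul, Set.image_image]
  simp only [dot_smul_left, smul_eq_mul, mul_div_assoc]

theorem IsAntinorm.le_add {d : ℕ} {f : (Fin d → ℝ) → ℝ} (hf : IsAntinorm f)
    {x y : Fin d → ℝ} (hx : x ∈ pos d) (hy : y ∈ pos d) : f x ≤ f (x + y) := by
  have h := hf.2.2.1.2 hx hy (by norm_num : (0 : ℝ) ≤ 1 / 2) (by norm_num : (0 : ℝ) ≤ 1 / 2)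
    (by norm_num)
  rw [← smul_add, ← smul_add, hf.2.1 _ (add_mem_pos hx hy) _ (by norm_num), smul_eq_mul] at h
  linarith [hf.1 y hy]

/-- If a positively homogeneous function grows by a factor of at least `c` under a homogeneous
map on its superlevel set at height one, it does so wherever it is nonnegative. -/
theorem mul_le_map_of_one_le {d : ℕ} {g : (Fin d → ℝ) → ℝ} (A : Matrix (Fin d) (Fin d) ℝ)
    (hA : ∀ x ∈ pos d, A.mulVec x ∈ pos d) (hg : ∀ x ∈ pos d, 0 ≤ g x)
    (hhom : ∀ x ∈ pos d, ∀ l : ℝ, 0 ≤ l → g (l • x) = l * g x) {c : ℝ}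
    (h : ∀ x ∈ pos d, 1 ≤ g x → c ≤ g (A.mulVec x)) {x : Fin d → ℝ} (hx : x ∈ pos d) :
    c * g x ≤ g (A.mulVec x) := by
  rcases (hg x hx).eq_or_lt with h0 | h0
  · rw [← h0, mul_zero]
    exact hg _ (hA x hx)
  · have hl := (inv_pos.2 h0).le
    have := h ((g x)⁻¹ • x) (smul_mem_pos hl hx)
      (by rw [hhom x hx _ hl, inv_mul_cancel₀ h0.ne'])
    rwa [Matrix.mulVec_smul, hhom _ (hA x hx) _ hl, ← div_eq_inv_mul, le_div_iff₀ h0] at this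

/-- The nontrivial half of biduality: `f` is bounded below by its second dual. -/
theorem exists_dot_lt_mul_dualAntinorm {d : ℕ} {f : (Fin d → ℝ) → ℝ} (hf : IsAntinorm f)
    (hc : ContinuousOn f (pos d)) {y : Fin d → ℝ} {t : ℝ} (ht : 0 < t)
    (hyt : f y < t) : ∃ p ∈ pos d, dot p y < t * dualAntinorm f p := by
  set K : Set (Fin d → ℝ) := {x ∈ pos d | t ≤ f x}
  have hKclosed : IsClosed K := hc.preimage_isClosed_of_isClosed (isClosed_pos d) isClosed_Ici
  obtain ⟨φ, u, hu, hφ⟩ := geometric_hahn_banach_point_closed (hf.2.2.1.convex_ge t) hKclosed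
    (fun h : y ∈ K => hyt.not_ge h.2)
  set p : Fin d → ℝ := fun i => φ (Pi.single i 1)
  have hdot (x : Fin d → ℝ) : φ x = dot p x := by
    conv_lhs => rw [pi_eq_sum_univ' x, map_sum]
    refine Finset.sum_congr rfl fun i _ => ?_
    rw [map_smul, smul_eq_mul, mul_comm]
  have hscale {x : Fin d → ℝ} (hx : x ∈ pos d) (hfx : 0 < f x) : (t / f x) • x ∈ K :=
    ⟨smul_mem_pos (div_pos ht hfx).le hx, by
      rw [hf.2.1 x hx _ (div_pos ht hfx).le, div_mul_cancel₀ _ hfx.ne']⟩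
  have hp : p ∈ pos d := by
    intro i
    obtain ⟨x, hx, hfx⟩ := hf.2.2.2
    by_contra! hi
    obtain ⟨z, hz⟩ : K.Nonempty := ⟨_, hscale hx hfx⟩
    have hl : 0 ≤ (φ z - u) / (-p i) := div_nonneg (by linarith [hφ z hz]) (by linarith)
    have he : ((φ z - u) / (-p i)) • (Pi.single i 1 : Fin d → ℝ) ∈ pos d :=
      smul_mem_pos hl fun j => by
        by_cases hj : j = i
        · subst hj; simp
        · simp [hj]
    have := hφ _ ⟨add_mem_pos hz.1 he, hz.2.trans (hf.le_add hz.1 he)⟩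
    rw [map_add, map_smul, smul_eq_mul] at this
    change u < φ z + (φ z - u) / (-p i) * p i at this
    rw [div_mul_eq_mul_div, div_neg, mul_div_cancel_right₀ _ hi.ne] at this
    linarith
  refine ⟨p, hp, ?_⟩
  have : u / t ≤ dualAntinorm f p := by
    refine le_dualAntinorm hf fun x hx hfx => ?_
    have := hφ _ (hscale hx hfx)
    rw [hdot, dot_smul_right, div_mul_eq_mul_div, lt_div_iff₀ hfx] at this
    rw [div_mul_eq_mul_div, div_le_iff₀ ht]
    linarith
  rw [div_le_iff₀ ht] at this
  linarith [hdot y]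

/-- Duality of extremal antinorms for the lower spectral radius (normalized case):
if a continuous antinorm `f` is extremal for a compact nonempty family `𝒜` of
nonnegative matrices, i.e. `inf {f(Ax) : f(x) ≥ 1, A ∈ 𝒜} = 1`, then `f*` is
extremal for the transposed family `𝒜ᵀ`. -/
theorem dual_extremal_antinorm_transpose (d : ℕ)
    (𝒜 : Set (Matrix (Fin d) (Fin d) ℝ))
    (hcomp : IsCompact 𝒜) (hne : 𝒜.Nonempty)
    (hnn : ∀ A ∈ 𝒜, ∀ i j, 0 ≤ A i j)
    (f : (Fin d → ℝ) → ℝ)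
    (hf : IsAntinorm f) (hc : ContinuousOn f (pos d))
    (hext : sInf {r | ∃ A ∈ 𝒜, ∃ x ∈ pos d, 1 ≤ f x ∧ r = f (A.mulVec x)} = 1) :
    sInf {r | ∃ A ∈ 𝒜, ∃ p ∈ pos d, 1 ≤ dualAntinorm f p ∧
      r = dualAntinorm f (A.transpose.mulVec p)} = 1 := by
  have hlow : ∀ A ∈ 𝒜, ∀ x ∈ pos d, f x ≤ f (A.mulVec x) := by
    intro A hA x hx
    rw [← one_mul (f x)]
    refine mul_le_map_of_one_le A (fun x => mulVec_mem_pos (hnn A hA)) hf.1 hf.2.1 ?_ hx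
    intro x hx hfx
    rw [← hext]
    refine csInf_le ⟨0, ?_⟩ ⟨A, hA, x, hx, hfx, rfl⟩
    rintro _ ⟨B, hB, z, hz, -, rfl⟩
    exact hf.1 _ (mulVec_mem_pos (hnn B hB) hz)
  have hdual : ∀ A ∈ 𝒜, ∀ p ∈ pos d,
      dualAntinorm f p ≤ dualAntinorm f (A.transpose.mulVec p) := by
    intro A hA p hp
    refine le_dualAntinorm hf fun x hx _ => ?_
    rw [dot_transpose_mulVec]
    exact (mul_le_mul_of_nonneg_left (hlow A hA x hx) (dualAntinorm_nonneg hf hp)).trans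
      (dualAntinorm_mul_le_dot hf hp (mulVec_mem_pos (hnn A hA) hx))
  have hbound : ∀ r ∈ {r | ∃ A ∈ 𝒜, ∃ p ∈ pos d, 1 ≤ dualAntinorm f p ∧
      r = dualAntinorm f (A.transpose.mulVec p)}, 1 ≤ r := by
    rintro _ ⟨A, hA, p, hp, hp1, rfl⟩
    exact hp1.trans (hdual A hA p hp)
  refine le_antisymm ?_ (le_csInf ?_ hbound)
  · set c := sInf {r | ∃ A ∈ 𝒜, ∃ p ∈ pos d, 1 ≤ dualAntinorm f p ∧
      r = dualAntinorm f (A.transpose.mulVec p)}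
    by_contra! hc1
    have hcpos : 0 < c := zero_lt_one.trans hc1
    have hgrow : ∀ A ∈ 𝒜, ∀ p ∈ pos d,
        c * dualAntinorm f p ≤ dualAntinorm f (A.transpose.mulVec p) := by
      intro A hA p hp
      refine mul_le_map_of_one_le A.transpose
        (fun x => mulVec_mem_pos fun i j => hnn A hA j i)
        (fun x => dualAntinorm_nonneg hf) (fun x _ l hl => dualAntinorm_smul f hl x) ?_ hp
      intro q hq hq1
      exact csInf_le ⟨1, hbound⟩ ⟨A, hA, q, hq, hq1, rfl⟩
    refine hc1.not_ge (hext ▸ le_csInf ?_ ?_)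
    · exact Set.nonempty_iff_ne_empty.2 fun h => by simp [h] at hext
    · rintro _ ⟨A, hA, x, hx, hx1, rfl⟩
      by_contra! hlt
      have hAx := mulVec_mem_pos (hnn A hA) hx
      have hfx : 0 < f x := zero_lt_one.trans_le hx1
      obtain ⟨p, hp, hlt'⟩ := exists_dot_lt_mul_dualAntinorm hf hc (mul_pos hcpos hfx)
        (hlt.trans_le (le_mul_of_one_le_right hcpos.le hx1))
      have h1 := dualAntinorm_mul_le_dot (p := A.transpose.mulVec p) hf
        (mulVec_mem_pos (fun i j => hnn A hA j i) hp) hx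
      rw [dot_transpose_mulVec] at h1
      have h2 := mul_le_mul_of_nonneg_right (hgrow A hA p hp) hfx.le
      linarith
  · obtain ⟨A, hA⟩ := hne
    have h0 : (0 : Fin d → ℝ) ∈ pos d := fun _ => le_rfl
    have hf0 : f 0 = 0 := by simpa using hf.2.1 0 h0 0 le_rfl
    obtain ⟨p, hp, hlt⟩ := exists_dot_lt_mul_dualAntinorm hf hc zero_lt_one
      (hf0.trans_lt zero_lt_one)
    have hpos : 0 < dualAntinorm f p := by
      linarith [dot_nonneg hp h0]
    have hl := (inv_pos.2 hpos).le
    exact ⟨_, A, hA, _, smul_mem_pos hl hp,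
      by rw [dualAntinorm_smul f hl, inv_mul_cancel₀ hpos.ne'], rfl⟩
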